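/- Let γ > 0 and let H be a 3-graph on n vertices with δ₂(H) ≥ (1/2 − γ)n. Suppose X, Y is a bipartition of V(H), and let x, x' ∈ X and y₁, y₂ ∈ Y be such that {x,y₁,y₂}, {x,x',y₁}, {x,x',y₂} ∈ E(H). Then at least one of the following holds: (a) the 4-set {x,x',y₁,y₂} is contained in at least γn/4 5-sets of vertices that span (X,Y)-bridges of length 1; (b) there are at least γn/4 copies K of K₄³ in H with |V(K) ∩ X| = 2 = |V(K) ∩ Y| and |V(K) ∩ {x,x',y₁,y₂}| = 3; (c) (1/2 − 15γ/4)n ≤ |X|, |Y| ≤ (1/2 + 15γ/4)n and {x,x',y₁} is (26γ, X, Y)-typical. -/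

import Mathlib

open Finset

/-- `H` is the edge set of a 3-uniform hypergraph (3-graph) on `Fin n`. -/
def Is3Graph (n : ℕ) (H : Finset (Finset (Fin n))) : Prop :=
  ∀ e ∈ H, e.card = 3

/-- `degOn H x y U` : number of `z ∈ U` with `{x,y,z} ∈ H`, i.e. `deg_H(xy, U)`. -/
def degOn {n : ℕ} (H : Finset (Finset (Fin n))) (x y : Fin n) (U : Finset (Fin n)) : ℕ :=
  (U.filter fun z => ({x, y, z} : Finset (Fin n)) ∈ H).card

/-- The minimum codegree `δ₂(H)` is at least `t`. -/
def CodegLB {n : ℕ} (H : Finset (Finset (Fin n))) (t : ℝ) : Prop :=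
  ∀ x y : Fin n, x ≠ y → t ≤ (degOn H x y Finset.univ : ℝ)

/-- `S` spans a copy of `K₄⁻` in `H`: it has 4 vertices and at least 3 of its
four 3-subsets are edges. -/
def SpansK4m {n : ℕ} (H : Finset (Finset (Fin n))) (S : Finset (Fin n)) : Prop :=
  S.card = 4 ∧ 3 ≤ ((S.powersetCard 3).filter (· ∈ H)).card

/-- `S` spans a copy of `K₄³` (the complete 3-graph on 4 vertices) in `H`. -/
def SpansK43 {n : ℕ} (H : Finset (Finset (Fin n))) (S : Finset (Fin n)) : Prop :=
  S.card = 4 ∧ ((S.powersetCard 3).filter (· ∈ H)).card = 4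

/-- The induced subgraph `H[X]` contains a `K₄⁻`-factor. -/
def HasK4mFactorOn {n : ℕ} (H : Finset (Finset (Fin n))) (X : Finset (Fin n)) : Prop :=
  ∃ P : Finset (Finset (Fin n)),
    (∀ S ∈ P, SpansK4m H S) ∧
    (∀ S ∈ P, ∀ T ∈ P, S ≠ T → Disjoint S T) ∧
    P.biUnion id = X

/-- `S` is an `(x,y)`-connector of length `c` in `H`. -/
def IsConnector {n : ℕ} (H : Finset (Finset (Fin n))) (c : ℕ) (x y : Fin n)
    (S : Finset (Fin n)) : Prop :=
  x ∉ S ∧ y ∉ S ∧ S.card = 4 * c - 1 ∧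
    HasK4mFactorOn H (insert x S) ∧ HasK4mFactorOn H (insert y S)

/-- `x` and `y` are `(c,η)`-close in `H` (a 3-graph on `n` vertices). -/
def Close {n : ℕ} (H : Finset (Finset (Fin n))) (c : ℕ) (η : ℝ) (x y : Fin n) : Prop :=
  η * (n : ℝ) ^ (4 * c - 1) ≤ ({S : Finset (Fin n) | IsConnector H c x y S}.ncard : ℝ)

/-- `U` is `(c,η)`-closed in `H`. -/
def ClosedOn {n : ℕ} (H : Finset (Finset (Fin n))) (c : ℕ) (η : ℝ)
    (U : Finset (Fin n)) : Prop :=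
  ∀ x ∈ U, ∀ y ∈ U, x ≠ y → Close H c η x y

/-- The number of `(X,Y)`-bridges `(x,y,S)` of length `c` in `H`. -/
noncomputable def BridgeCount {n : ℕ} (H : Finset (Finset (Fin n))) (c : ℕ)
    (X Y : Finset (Fin n)) : ℕ :=
  {t : Fin n × Fin n × Finset (Fin n) |
    t.1 ∈ X ∧ t.2.1 ∈ Y ∧ IsConnector H c t.1 t.2.1 t.2.2}.ncard

/-- The 3-graph `𝓑[A,B]`: all triples in `A ∪ B` containing an odd number of
vertices of `A`. -/
def BGraph {n : ℕ} (A B : Finset (Fin n)) : Finset (Finset (Fin n)) :=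
  ((A ∪ B).powersetCard 3).filter fun e => (e ∩ A).card % 2 = 1

/-- `H` (a 3-graph on `n` vertices) is `γ`-extremal. -/
def IsExtremal {n : ℕ} (H : Finset (Finset (Fin n))) (γ : ℝ) : Prop :=
  ∃ A B : Finset (Fin n), Disjoint A B ∧ A ∪ B = Finset.univ ∧
    A.card = n / 2 ∧ B.card = n - n / 2 ∧
    ((BGraph A B \ H).card : ℝ) ≤ γ * (n : ℝ) ^ 3

/-- The number of `V₁V₂V₃`-edges of `H`. -/
def eCount {n : ℕ} (H : Finset (Finset (Fin n))) (A B C : Finset (Fin n)) : ℕ :=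
  (H.filter fun e => ∃ a ∈ A, ∃ b ∈ B, ∃ c ∈ C, e = {a, b, c}).card

/-- `Ñ_{c,η}(x)` : the set of vertices `(c,η)`-close to `x` in `H`. -/
def Ntilde {n : ℕ} (H : Finset (Finset (Fin n))) (c : ℕ) (η : ℝ) (x : Fin n) :
    Set (Fin n) :=
  {y | y ≠ x ∧ Close H c η x y}

/-- The triple `{x,x',y}` is `(ρ,X,Y)`-typical. -/
def TypicalTriple {n : ℕ} (H : Finset (Finset (Fin n))) (ρ : ℝ) (X Y : Finset (Fin n))
    (x x' y : Fin n) : Prop :=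
  (Y.card : ℝ) - ρ * n ≤ (degOn H x x' Y : ℝ) ∧
  (((X.filter fun z => ({x, y, z} : Finset (Fin n)) ∈ H ∧
      ({x', y, z} : Finset (Fin n)) ∈ H).card : ℝ) ≤ ρ * n) ∧
  (X.card : ℝ) - ρ * n ≤ (degOn H x y X : ℝ) + (degOn H x' y X : ℝ)

/-- `Q` spans an `(X,Y)`-bridge of length 1, i.e. `Q = {a,b} ∪ S` for some
`(X,Y)`-bridge `(a,b,S)` of length 1. -/
def SpansBridge1 {n : ℕ} (H : Finset (Finset (Fin n))) (X Y Q : Finset (Fin n)) : Prop :=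
  ∃ a ∈ X, ∃ b ∈ Y, ∃ S : Finset (Fin n), IsConnector H 1 a b S ∧
    Q = insert a (insert b S)

/-- indicator of the edge `{p,q,z}` -/
def eInd {n : ℕ} (H : Finset (Finset (Fin n))) (p q z : Fin n) : ℕ :=
  if ({p, q, z} : Finset (Fin n)) ∈ H then 1 else 0

theorem eInd_le {n : ℕ} (H : Finset (Finset (Fin n))) (p q z : Fin n) : eInd H p q z ≤ 1 := by
  unfold eInd; split_ifs <;> simp

theorem eInd_mem {n : ℕ} {H : Finset (Finset (Fin n))} {p q z : Fin n} (h : eInd H p q z = 1) :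
    ({p, q, z} : Finset (Fin n)) ∈ H := by
  unfold eInd at h; by_contra h'; simp [h'] at h

theorem eInd_of_mem {n : ℕ} {H : Finset (Finset (Fin n))} {p q z : Fin n}
    (h : ({p, q, z} : Finset (Fin n)) ∈ H) : eInd H p q z = 1 := by
  simp [eInd, h]

theorem eInd_left {n : ℕ} {H : Finset (Finset (Fin n))} (h3 : Is3Graph n H) (p q : Fin n) :
    eInd H p q p = 0 := by
  have : ({p, q, p} : Finset (Fin n)) ∉ H := by
    intro h
    have h1 := h3 _ h
    have h2 : ({p, q, p} : Finset (Fin n)) = {p, q} := by ext; simp only [Finset.mem_insert, Finset.mem_singleton, Finset.mem_union]; clear * -; tauto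
    have := Finset.card_le_two (a := p) (b := q)
    rw [h2] at h1; omega
  exact if_neg this

theorem eInd_right {n : ℕ} {H : Finset (Finset (Fin n))} (h3 : Is3Graph n H) (p q : Fin n) :
    eInd H p q q = 0 := by
  have : ({p, q, q} : Finset (Fin n)) ∉ H := by
    intro h
    have h1 := h3 _ h
    have h2 : ({p, q, q} : Finset (Fin n)) = {p, q} := by ext; simp
    have := Finset.card_le_two (a := p) (b := q)
    rw [h2] at h1; omega
  exact if_neg this

theorem card4 {n : ℕ} {p q r s : Fin n} (h1 : p ≠ q) (h2 : p ≠ r) (h3 : p ≠ s)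
    (h4 : q ≠ r) (h5 : q ≠ s) (h6 : r ≠ s) : ({p, q, r, s} : Finset (Fin n)).card = 4 := by
  simp [Finset.card_insert_of_notMem, *]

theorem k4m_of {n : ℕ} {H : Finset (Finset (Fin n))} (hH : Is3Graph n H) {p q r s : Fin n}
    (h1 : p ≠ q) (h2 : p ≠ r) (h3 : p ≠ s) (h4 : q ≠ r) (h5 : q ≠ s) (h6 : r ≠ s)
    (e1 : ({p, q, r} : Finset (Fin n)) ∈ H) (e2 : ({p, q, s} : Finset (Fin n)) ∈ H)
    (e3 : ({p, r, s} : Finset (Fin n)) ∈ H) : SpansK4m H {p, q, r, s} := by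
  refine ⟨card4 h1 h2 h3 h4 h5 h6, ?_⟩
  have hc : ({{p, q, r}, {p, q, s}, {p, r, s}} : Finset (Finset (Fin n))).card = 3 := by
    rw [Finset.card_eq_three]
    refine ⟨_, _, _, ?_, ?_, ?_, rfl⟩
    · intro h; have := Finset.ext_iff.1 h r; simp at this; clear h; clear e1 e2 e3 hH; grind
    · intro h; have := Finset.ext_iff.1 h q; simp at this; clear h; clear e1 e2 e3 hH; grind
    · intro h; have := Finset.ext_iff.1 h q; simp at this; clear h; clear e1 e2 e3 hH; grind
  refine hc.symm.le.trans ?_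
  apply Finset.card_le_card
  intro e he
  simp only [Finset.mem_insert, Finset.mem_singleton] at he
  rw [Finset.mem_filter, Finset.mem_powersetCard]
  rcases he with rfl | rfl | rfl
  · exact ⟨⟨by intro t; simp only [Finset.mem_insert, Finset.mem_singleton]; clear * -; tauto, hH _ e1⟩, e1⟩
  · exact ⟨⟨by intro t; simp only [Finset.mem_insert, Finset.mem_singleton]; clear * -; tauto, hH _ e2⟩, e2⟩
  · exact ⟨⟨by intro t; simp only [Finset.mem_insert, Finset.mem_singleton]; clear * -; tauto, hH _ e3⟩, e3⟩

set_option maxHeartbeats 4000000 in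
theorem k43_of {n : ℕ} {H : Finset (Finset (Fin n))} (hH : Is3Graph n H) {p q r s : Fin n}
    (h1 : p ≠ q) (h2 : p ≠ r) (h3 : p ≠ s) (h4 : q ≠ r) (h5 : q ≠ s) (h6 : r ≠ s)
    (e1 : ({p, q, r} : Finset (Fin n)) ∈ H) (e2 : ({p, q, s} : Finset (Fin n)) ∈ H)
    (e3 : ({p, r, s} : Finset (Fin n)) ∈ H) (e4 : ({q, r, s} : Finset (Fin n)) ∈ H) :
    SpansK43 H {p, q, r, s} := by
  have h0 := card4 h1 h2 h3 h4 h5 h6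
  refine ⟨h0, ?_⟩
  have hc : ({{p, q, r}, {p, q, s}, {p, r, s}, {q, r, s}} : Finset (Finset (Fin n))).card = 4 := by
    rw [Finset.card_eq_succ]
    refine ⟨{p, q, r}, {{p, q, s}, {p, r, s}, {q, r, s}}, ?_, rfl, ?_⟩
    · simp only [Finset.mem_insert, Finset.mem_singleton]
      rintro (h | h | h)
      · have := Finset.ext_iff.1 h r; simp at this; clear h; clear e1 e2 e3 hH; grind
      · have := Finset.ext_iff.1 h q; simp at this; clear h; clear e1 e2 e3 hH; grind
      · have := Finset.ext_iff.1 h p; simp at this; clear h; clear e1 e2 e3 hH; grind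
    · rw [Finset.card_eq_three]
      refine ⟨_, _, _, ?_, ?_, ?_, rfl⟩
      · intro h; have := Finset.ext_iff.1 h r; simp at this; clear h; clear e1 e2 e3 hH; grind
      · intro h; have := Finset.ext_iff.1 h p; simp at this; clear h; clear e1 e2 e3 hH; grind
      · intro h; have := Finset.ext_iff.1 h p; simp at this; clear h; clear e1 e2 e3 hH; grind
  apply le_antisymm
  · refine (Finset.card_filter_le _ _).trans ?_
    rw [Finset.card_powersetCard, h0]; decide
  · refine hc.symm.le.trans ?_
    apply Finset.card_le_card
    intro e he
    simp only [Finset.mem_insert, Finset.mem_singleton] at he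
    rw [Finset.mem_filter, Finset.mem_powersetCard]
    rcases he with rfl | rfl | rfl | rfl
    · exact ⟨⟨by intro t; simp only [Finset.mem_insert, Finset.mem_singleton]; clear * -; tauto, hH _ e1⟩, e1⟩
    · exact ⟨⟨by intro t; simp only [Finset.mem_insert, Finset.mem_singleton]; clear * -; tauto, hH _ e2⟩, e2⟩
    · exact ⟨⟨by intro t; simp only [Finset.mem_insert, Finset.mem_singleton]; clear * -; tauto, hH _ e3⟩, e3⟩
    · exact ⟨⟨by intro t; simp only [Finset.mem_insert, Finset.mem_singleton]; clear * -; tauto, hH _ e4⟩, e4⟩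

theorem factor_of {n : ℕ} {H : Finset (Finset (Fin n))} {S : Finset (Fin n)}
    (h : SpansK4m H S) : HasK4mFactorOn H S :=
  ⟨{S}, by simpa using h, by simp, by simp⟩

theorem bridge_of {n : ℕ} {H : Finset (Finset (Fin n))} {X Y C : Finset (Fin n)} {z w : Fin n}
    (hC : SpansK4m H C) (hw : w ∈ C) (hz : z ∉ C)
    (hzw : (z ∈ X ∧ w ∈ Y) ∨ (z ∈ Y ∧ w ∈ X))
    (hk : SpansK4m H (insert z (C.erase w))) :
    (insert z C).card = 5 ∧ C ⊆ insert z C ∧ SpansBridge1 H X Y (insert z C) := by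
  have hi : insert w (C.erase w) = C := Finset.insert_erase hw
  have hzS : z ∉ C.erase w := fun h => hz (Finset.mem_of_mem_erase h)
  have hcS : (C.erase w).card = 4 * 1 - 1 := by
    rw [Finset.card_erase_of_mem hw, hC.1]
  have f1 := factor_of hk
  have f2 : HasK4mFactorOn H (insert w (C.erase w)) := by rw [hi]; exact factor_of hC
  refine ⟨by rw [Finset.card_insert_of_notMem hz, hC.1], Finset.subset_insert _ _, ?_⟩
  rcases hzw with ⟨h1, h2⟩ | ⟨h1, h2⟩
  · exact ⟨z, h1, w, h2, C.erase w, ⟨hzS, Finset.notMem_erase _ _, hcS, f1, f2⟩, by rw [hi]⟩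
  · exact ⟨w, h2, z, h1, C.erase w, ⟨Finset.notMem_erase _ _, hzS, hcS, f2, f1⟩, by
      rw [Finset.insert_comm, hi]⟩

/-- two of three further edges complete a given edge to a `K₄⁻`. -/
theorem k4m_two {n : ℕ} {H : Finset (Finset (Fin n))} (hH : Is3Graph n H) {p q r z : Fin n}
    (h1 : p ≠ q) (h2 : p ≠ r) (h4 : q ≠ r) (h3 : z ≠ p) (h5 : z ≠ q) (h6 : z ≠ r)
    (e : ({p, q, r} : Finset (Fin n)) ∈ H)
    (h : 2 ≤ eInd H p q z + eInd H p r z + eInd H q r z) : SpansK4m H {p, q, r, z} := by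
  have l1 := eInd_le H p q z
  have l2 := eInd_le H p r z
  have l3 := eInd_le H q r z
  have hc : (eInd H p q z = 1 ∧ eInd H p r z = 1) ∨ (eInd H p q z = 1 ∧ eInd H q r z = 1) ∨
    (eInd H p r z = 1 ∧ eInd H q r z = 1) := by omega
  rcases hc with ⟨a, b⟩ | ⟨a, b⟩ | ⟨a, b⟩
  · exact k4m_of hH h1 h2 h3.symm h4 h5.symm h6.symm e (eInd_mem a) (eInd_mem b)
  · have := k4m_of hH (p := q) (q := p) (r := r) (s := z) h1.symm h4 h5.symm h2 h3.symm h6.symm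
      (by rw [Finset.insert_comm]; exact e)
      (by rw [Finset.insert_comm]; exact eInd_mem a) (eInd_mem b)
    rwa [Finset.insert_comm] at this
  · have h := k4m_of hH (p := r) (q := p) (r := q) (s := z) h2.symm h4.symm h6.symm h1 h3.symm
      h5.symm
      (by convert e using 1; ext; simp only [Finset.mem_insert, Finset.mem_singleton, Finset.mem_union]; clear * -; tauto)
      (by rw [Finset.insert_comm]; exact eInd_mem a)
      (by rw [Finset.insert_comm]; exact eInd_mem b)
    convert h using 1; ext; simp only [Finset.mem_insert, Finset.mem_singleton, Finset.mem_union]; clear * -; tauto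

theorem k4m_three {n : ℕ} {H : Finset (Finset (Fin n))} (hH : Is3Graph n H) {p q r z : Fin n}
    (h1 : p ≠ q) (h2 : p ≠ r) (h4 : q ≠ r) (h3 : z ≠ p) (h5 : z ≠ q) (h6 : z ≠ r)
    (h : 3 ≤ eInd H p q z + eInd H p r z + eInd H q r z) : SpansK4m H {p, q, r, z} := by
  have l1 := eInd_le H p q z
  have l2 := eInd_le H p r z
  have l3 := eInd_le H q r z
  have a : eInd H p q z = 1 := by omega
  have b : eInd H p r z = 1 := by omega
  have c : eInd H q r z = 1 := by omega
  have h := k4m_of hH (p := z) (q := p) (r := q) (s := r) h3 h5 h6 h1 h2 h4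
    (by convert eInd_mem a using 1; ext; simp only [Finset.mem_insert, Finset.mem_singleton, Finset.mem_union]; clear * -; tauto)
    (by convert eInd_mem b using 1; ext; simp only [Finset.mem_insert, Finset.mem_singleton, Finset.mem_union]; clear * -; tauto)
    (by convert eInd_mem c using 1; ext; simp only [Finset.mem_insert, Finset.mem_singleton, Finset.mem_union]; clear * -; tauto)
  convert h using 1; ext; simp only [Finset.mem_insert, Finset.mem_singleton, Finset.mem_union]; clear * -; tauto

theorem k43_three {n : ℕ} {H : Finset (Finset (Fin n))} (hH : Is3Graph n H) {p q r z : Fin n}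
    (h1 : p ≠ q) (h2 : p ≠ r) (h4 : q ≠ r) (h3 : z ≠ p) (h5 : z ≠ q) (h6 : z ≠ r)
    (e : ({p, q, r} : Finset (Fin n)) ∈ H)
    (h : 3 ≤ eInd H p q z + eInd H p r z + eInd H q r z) : SpansK43 H {p, q, r, z} := by
  have l1 := eInd_le H p q z
  have l2 := eInd_le H p r z
  have l3 := eInd_le H q r z
  have a : eInd H p q z = 1 := by omega
  have b : eInd H p r z = 1 := by omega
  have c : eInd H q r z = 1 := by omega
  exact k43_of hH h1 h2 h3.symm h4 h5.symm h6.symm e (eInd_mem a) (eInd_mem b) (eInd_mem c)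

theorem sum_eInd {n : ℕ} (H : Finset (Finset (Fin n))) (p q : Fin n) :
    ∑ z, eInd H p q z = degOn H p q Finset.univ := by
  simp [eInd, degOn]

theorem sum_eInd_on {n : ℕ} (H : Finset (Finset (Fin n))) (p q : Fin n) (X : Finset (Fin n)) :
    ∑ z, (if z ∈ X then 1 else 0) * eInd H p q z = degOn H p q X := by
  unfold degOn eInd
  rw [Finset.card_filter]
  simp only [ite_mul, one_mul, zero_mul, Finset.sum_ite_mem, Finset.univ_inter]

/-- exactly one new vertex: the hypotheses of (b) -/
theorem copy_of {n : ℕ} {H : Finset (Finset (Fin n))} {X Y C : Finset (Fin n)}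
    (hd : Disjoint X Y) {u v s t : Fin n}
    (hk : SpansK43 H {u, v, s, t}) (hu : u ∈ X) (hv : v ∈ X) (hs : s ∈ Y) (ht : t ∈ Y)
    {z : Fin n} (hz : z ∈ ({u, v, s, t} : Finset (Fin n)))
    (hC : ({u, v, s, t} : Finset (Fin n)) \ C = {z}) :
    ∃ S : Finset (Fin n), (SpansK43 H S ∧ (S ∩ X).card = 2 ∧ (S ∩ Y).card = 2 ∧
      (S ∩ C).card = 3) ∧ S \ C = {z} := by
  have huY : u ∉ Y := Finset.disjoint_left.1 hd hu
  have hvY : v ∉ Y := Finset.disjoint_left.1 hd hv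
  have hsX : s ∉ X := Finset.disjoint_right.1 hd hs
  have htX : t ∉ X := Finset.disjoint_right.1 hd ht
  have e1 : ({u, v, s, t} : Finset (Fin n)) ∩ X = {u, v} := by
    ext w; simp; grind
  have e2 : ({u, v, s, t} : Finset (Fin n)) ∩ Y = {s, t} := by
    ext w; simp; grind
  have c4 := hk.1
  have b1 := Finset.card_le_two (a := u) (b := v)
  have b2 := Finset.card_le_two (a := s) (b := t)
  have hun : ({u, v, s, t} : Finset (Fin n)) = {u, v} ∪ {s, t} := by ext; simp only [Finset.mem_insert, Finset.mem_singleton, Finset.mem_union]; clear * -; tauto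
  have b3 := Finset.card_union_le ({u, v} : Finset (Fin n)) {s, t}
  rw [← hun] at b3
  have b4 := Finset.card_sdiff_add_card_inter ({u, v, s, t} : Finset (Fin n)) C
  rw [hC, Finset.card_singleton] at b4
  refine ⟨{u, v, s, t}, ⟨hk, ?_, ?_, by omega⟩, hC⟩
  · rw [e1]; omega
  · rw [e2]; omega

set_option maxHeartbeats 4000000 in
theorem key_pointwise {n : ℕ} {H : Finset (Finset (Fin n))} (h3 : Is3Graph n H)
    {X Y : Finset (Fin n)} (hd : Disjoint X Y) (hp : X ∪ Y = Finset.univ)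
    {x x' y₁ y₂ : Fin n} (hx : x ∈ X) (hx' : x' ∈ X) (hy₁ : y₁ ∈ Y) (hy₂ : y₂ ∈ Y)
    (hxx' : x ≠ x') (hy12 : y₁ ≠ y₂)
    (he1 : ({x, y₁, y₂} : Finset (Fin n)) ∈ H)
    (he2 : ({x, x', y₁} : Finset (Fin n)) ∈ H)
    (he3 : ({x, x', y₂} : Finset (Fin n)) ∈ H)
    (FA : Finset (Fin n)) (hFA : ∀ z, z ∉ ({x, x', y₁, y₂} : Finset (Fin n)) →
      ((insert z ({x, x', y₁, y₂} : Finset (Fin n))).card = 5 ∧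
        ({x, x', y₁, y₂} : Finset (Fin n)) ⊆ insert z ({x, x', y₁, y₂} : Finset (Fin n)) ∧
        SpansBridge1 H X Y (insert z ({x, x', y₁, y₂} : Finset (Fin n)))) → z ∈ FA)
    (FB : Finset (Fin n)) (hFB : ∀ z, (∃ S : Finset (Fin n), (SpansK43 H S ∧
        (S ∩ X).card = 2 ∧ (S ∩ Y).card = 2 ∧
        (S ∩ ({x, x', y₁, y₂} : Finset (Fin n))).card = 3) ∧
        S \ ({x, x', y₁, y₂} : Finset (Fin n)) = {z}) → z ∈ FB)
    (z : Fin n) (a b1 b2 c1 c2 d iX iY iA iB : ℕ)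
    (ha : a = eInd H x x' z) (hb1 : b1 = eInd H x y₁ z) (hb2 : b2 = eInd H x y₂ z)
    (hc1 : c1 = eInd H x' y₁ z) (hc2 : c2 = eInd H x' y₂ z) (hdd : d = eInd H y₁ y₂ z)
    (hiX : iX = if z ∈ X then 1 else 0) (hiY : iY = if z ∈ Y then 1 else 0)
    (hiA : iA = if z ∈ FA then 1 else 0) (hiB : iB = if z ∈ FB then 1 else 0) :
    (b1 + b2 + d + (if z = x then 1 else 0) ≤ 1 + iX + 2 * iA + iB + (if z = x' then 1 else 0)) ∧
    (a + b1 + c1 + (if z = y₁ then 1 else 0) ≤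
      1 + iY + 2 * iA + iB + (if z = y₂ then 1 else 0)) ∧
    (a + b1 + b2 + c1 + c2 + d + iX * a ≤ 3 + 4 * iA + iB) ∧
    (a + b1 + b2 + c1 + c2 + d + iX ≤ 3 + 4 * iA + iB + (iX * b1 + iX * c1)) ∧
    (z ∈ X → b1 = 1 → c1 = 1 → z ∈ FA) := by
  have hxY : x ∉ Y := Finset.disjoint_left.1 hd hx
  have hxY' : x' ∉ Y := Finset.disjoint_left.1 hd hx'
  have hyX₁ : y₁ ∉ X := Finset.disjoint_right.1 hd hy₁
  have hyX₂ : y₂ ∉ X := Finset.disjoint_right.1 hd hy₂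
  have n1 : x ≠ y₁ := fun h => hxY (h ▸ hy₁)
  have n2 : x ≠ y₂ := fun h => hxY (h ▸ hy₂)
  have n3 : x' ≠ y₁ := fun h => hxY' (h ▸ hy₁)
  have n4 : x' ≠ y₂ := fun h => hxY' (h ▸ hy₂)
  have la : a ≤ 1 := ha ▸ eInd_le _ _ _ _
  have lb1 : b1 ≤ 1 := hb1 ▸ eInd_le _ _ _ _
  have lb2 : b2 ≤ 1 := hb2 ▸ eInd_le _ _ _ _
  have lc1 : c1 ≤ 1 := hc1 ▸ eInd_le _ _ _ _
  have lc2 : c2 ≤ 1 := hc2 ▸ eInd_le _ _ _ _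
  have ld : d ≤ 1 := hdd ▸ eInd_le _ _ _ _
  have hcore : SpansK4m H {x, x', y₁, y₂} := k4m_of h3 hxx' n1 n2 n3 n4 hy12 he2 he3 he1
  by_cases zx : z = x
  · subst zx
    rw [eInd_left h3] at ha hb1 hb2
    simp only [hx, if_true, hxx', n1, n2, if_false, hxY] at *
    subst hiX
    refine ⟨by omega, by omega, by omega, ?_, by omega⟩
    have : c1 = 1 := by
      rw [hc1]; apply eInd_of_mem; convert he2 using 1; ext; simp only [Finset.mem_insert, Finset.mem_singleton]; clear * -; tauto
    omega
  by_cases zx' : z = x'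
  · subst zx'
    rw [eInd_right h3] at ha
    rw [eInd_left h3] at hc1 hc2
    simp only [hx', if_true, n3, n4, if_false, hxY', zx] at *
    subst hiX
    refine ⟨by omega, by omega, by omega, ?_, by omega⟩
    have : b1 = 1 := by
      rw [hb1]; apply eInd_of_mem; convert he2 using 1; ext; simp only [Finset.mem_insert, Finset.mem_singleton]; clear * -; tauto
    omega
  by_cases zy1 : z = y₁
  · subst zy1
    rw [eInd_right h3] at hb1 hc1
    rw [eInd_left h3] at hdd
    simp only [hy₁, if_true, hyX₁, hy12, if_false, zx, zx'] at *
    subst hiX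
    refine ⟨by omega, by omega, by omega, by omega, by omega⟩
  by_cases zy2 : z = y₂
  · subst zy2
    rw [eInd_right h3] at hb2 hc2 hdd
    simp only [hy₂, if_true, hyX₂, if_false, zx, zx', zy1] at *
    subst hiX
    refine ⟨by omega, by omega, by omega, by omega, by simp⟩
  have hzC : z ∉ ({x, x', y₁, y₂} : Finset (Fin n)) := by simp [zx, zx', zy1, zy2]
  have hA := hFA z hzC
  have hB := hFB z
  have hzXY : z ∈ X ∨ z ∈ Y := by
    have := Finset.mem_univ z
    rw [← hp] at this; simpa using this
  simp only [zx, zx', zy1, zy2, if_false]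
  rcases hzXY with hz | hz
  · have hz' : z ∉ Y := Finset.disjoint_left.1 hd hz
    simp only [hz, hz', if_true, if_false] at hiX hiY
    subst hiX hiY
    have F1 : z ∉ FA → a + b1 + c1 ≤ 1 := by
      intro hn; by_contra hcon
      refine hn (hA (bridge_of hcore (w := y₂) (by simp) hzC (Or.inl ⟨hz, hy₂⟩) ?_))
      have := k4m_two h3 hxx' n1 n3 zx zx' zy1 he2 (by omega)
      convert this using 1; clear * - hxx' n1 n2 n3 n4 hy12; ext; simp; grind
    have F2 : z ∉ FA → a + b2 + c2 ≤ 1 := by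
      intro hn; by_contra hcon
      refine hn (hA (bridge_of hcore (w := y₁) (by simp) hzC (Or.inl ⟨hz, hy₁⟩) ?_))
      have := k4m_two h3 hxx' n2 n4 zx zx' zy2 he3 (by omega)
      convert this using 1; clear * - hxx' n1 n2 n3 n4 hy12; ext; simp; grind
    have F3 : z ∉ FB → b1 + b2 + d ≤ 2 := by
      intro hn; by_contra hcon
      have h4 := k43_three h3 n1 n2 hy12 zx zy1 zy2 he1 (by omega)
      have h5 : ({x, y₁, y₂, z} : Finset (Fin n)) = {x, z, y₁, y₂} := by ext; simp only [Finset.mem_insert, Finset.mem_singleton]; clear * -; tauto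
      rw [h5] at h4
      refine hn (hB (copy_of hd h4 hx hz hy₁ hy₂ (z := z) (by simp) ?_))
      clear * - zx zx' zy1 zy2; ext; simp; grind
    by_cases hzA : z ∈ FA <;> by_cases hzB : z ∈ FB <;>
      simp only [hzA, hzB, if_true, if_false, not_true, not_false_eq_true, forall_const,
        false_imp_iff] at hiA hiB F1 F2 F3 ⊢ <;>
      subst hiA hiB <;>
      refine ⟨by omega, by omega, by omega, by omega, by first | omega | simp⟩
  · have hz' : z ∉ X := Finset.disjoint_right.1 hd hz
    simp only [hz, hz', if_true, if_false] at hiX hiY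
    subst hiX hiY
    have F1 : z ∉ FA → b1 + b2 + d ≤ 1 := by
      intro hn; by_contra hcon
      refine hn (hA (bridge_of hcore (w := x') (by simp) hzC (Or.inr ⟨hz, hx'⟩) ?_))
      have := k4m_two h3 n1 n2 hy12 zx zy1 zy2 he1 (by omega)
      convert this using 1; clear * - hxx' n1 n2 n3 n4 hy12; ext; simp; grind
    have F2 : z ∉ FA → c1 + c2 + d ≤ 2 := by
      intro hn; by_contra hcon
      refine hn (hA (bridge_of hcore (w := x) (by simp) hzC (Or.inr ⟨hz, hx⟩) ?_))
      have := k4m_three h3 n3 n4 hy12 zx' zy1 zy2 (by omega)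
      convert this using 1; clear * - hxx' n1 n2 n3 n4 hy12; ext; simp; grind
    have F3 : z ∉ FB → a + b1 + c1 ≤ 2 := by
      intro hn; by_contra hcon
      have h4 := k43_three h3 hxx' n1 n3 zx zx' zy1 he2 (by omega)
      refine hn (hB (copy_of hd h4 hx hx' hy₁ hz (z := z) (by simp) ?_))
      clear * - zx zx' zy1 zy2; ext; simp; grind
    have F4 : z ∉ FB → a + b2 + c2 ≤ 2 := by
      intro hn; by_contra hcon
      have h4 := k43_three h3 hxx' n2 n4 zx zx' zy2 he3 (by omega)
      refine hn (hB (copy_of hd h4 hx hx' hy₂ hz (z := z) (by simp) ?_))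
      clear * - zx zx' zy1 zy2; ext; simp; grind
    by_cases hzA : z ∈ FA <;> by_cases hzB : z ∈ FB <;>
      simp only [hzA, hzB, if_true, if_false, not_true, not_false_eq_true, forall_const,
        false_imp_iff] at hiA hiB F1 F2 F3 F4 ⊢ <;>
      subst hiA hiB <;>
      refine ⟨by omega, by omega, by omega, by omega, by first | omega | simp [hz']⟩

/-- a `K₄⁻`-copy across the bipartition gives many bridges, many
`K₄³`-copies, or a typical triple. -/
theorem stmt_17 (n : ℕ) (γ : ℝ) (hγ : 0 < γ)
    (H : Finset (Finset (Fin n))) (h3 : Is3Graph n H)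
    (hδ : CodegLB H ((1 / 2 - γ) * n))
    (X Y : Finset (Fin n)) (hd : Disjoint X Y) (hp : X ∪ Y = Finset.univ)
    (x x' y₁ y₂ : Fin n) (hx : x ∈ X) (hx' : x' ∈ X) (hy₁ : y₁ ∈ Y) (hy₂ : y₂ ∈ Y)
    (hxx' : x ≠ x') (hy12 : y₁ ≠ y₂)
    (he1 : ({x, y₁, y₂} : Finset (Fin n)) ∈ H)
    (he2 : ({x, x', y₁} : Finset (Fin n)) ∈ H)
    (he3 : ({x, x', y₂} : Finset (Fin n)) ∈ H) :
    (γ * n / 4 ≤ ({Q : Finset (Fin n) | Q.card = 5 ∧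
        ({x, x', y₁, y₂} : Finset (Fin n)) ⊆ Q ∧ SpansBridge1 H X Y Q}.ncard : ℝ)) ∨
    (γ * n / 4 ≤ ({S : Finset (Fin n) | SpansK43 H S ∧
        (S ∩ X).card = 2 ∧ (S ∩ Y).card = 2 ∧
        (S ∩ ({x, x', y₁, y₂} : Finset (Fin n))).card = 3}.ncard : ℝ)) ∨
    ((1 / 2 - 15 * γ / 4) * n ≤ (X.card : ℝ) ∧ (X.card : ℝ) ≤ (1 / 2 + 15 * γ / 4) * n ∧
     (1 / 2 - 15 * γ / 4) * n ≤ (Y.card : ℝ) ∧ (Y.card : ℝ) ≤ (1 / 2 + 15 * γ / 4) * n ∧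
     TypicalTriple H (26 * γ) X Y x x' y₁) := by
  classical
  by_cases hA0 : γ * n / 4 ≤ ({Q : Finset (Fin n) | Q.card = 5 ∧
        ({x, x', y₁, y₂} : Finset (Fin n)) ⊆ Q ∧ SpansBridge1 H X Y Q}.ncard : ℝ)
  · exact Or.inl hA0
  by_cases hB0 : γ * n / 4 ≤ ({S : Finset (Fin n) | SpansK43 H S ∧
        (S ∩ X).card = 2 ∧ (S ∩ Y).card = 2 ∧
        (S ∩ ({x, x', y₁, y₂} : Finset (Fin n))).card = 3}.ncard : ℝ)
  · exact Or.inr (Or.inl hB0)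
  refine Or.inr (Or.inr ?_)
  push Not at hA0 hB0
  set C : Finset (Fin n) := {x, x', y₁, y₂} with hC
  set SA : Set (Finset (Fin n)) := {Q | Q.card = 5 ∧ C ⊆ Q ∧ SpansBridge1 H X Y Q} with hSA
  set SB : Set (Finset (Fin n)) := {S | SpansK43 H S ∧ (S ∩ X).card = 2 ∧ (S ∩ Y).card = 2 ∧
    (S ∩ C).card = 3} with hSB
  set FA : Finset (Fin n) := Finset.univ.filter fun z => z ∉ C ∧ insert z C ∈ SA with hFA
  set FB : Finset (Fin n) := Finset.univ.filter fun z => ∃ S, S ∈ SB ∧ S \ C = {z} with hFB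
  have cA : FA.card ≤ SA.ncard := by
    rw [← Set.ncard_coe_finset]
    refine Set.ncard_le_ncard_of_injOn (fun z => insert z C) ?_ ?_ (Set.toFinite _)
    · intro z hz
      simp only [hFA, Finset.coe_filter, Finset.mem_univ, true_and, Set.mem_ofPred_eq] at hz
      exact hz.2
    · intro z hz w hw h
      simp only [hFA, Finset.coe_filter, Finset.mem_univ, true_and, Set.mem_ofPred_eq] at hz hw
      have h1 : z ∈ insert w C := by
        rw [← show insert z C = insert w C from h]; exact Finset.mem_insert_self _ _
      rcases Finset.mem_insert.1 h1 with h2 | h2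
      · exact h2
      · exact absurd h2 hz.1
  have cB : FB.card ≤ SB.ncard := by
    have hch : ∀ z : Fin n, ∃ S : Finset (Fin n), z ∈ FB → S ∈ SB ∧ S \ C = {z} := by
      intro z
      by_cases hz : z ∈ FB
      · have hz2 := hz
        simp only [hFB, Finset.mem_filter, Finset.mem_univ, true_and] at hz2
        obtain ⟨S, hS⟩ := hz2
        exact ⟨S, fun _ => hS⟩
      · exact ⟨∅, fun h => absurd h hz⟩
    choose f hf using hch
    rw [← Set.ncard_coe_finset]
    refine Set.ncard_le_ncard_of_injOn f ?_ ?_ (Set.toFinite _)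
    · intro z hz
      exact (hf z hz).1
    · intro z hz w hw h
      have h1 := (hf z hz).2
      rw [h, (hf w hw).2] at h1
      exact (Finset.singleton_injective h1).symm
  have key := fun z => key_pointwise h3 hd hp hx hx' hy₁ hy₂ hxx' hy12 he1 he2 he3 FA
    (fun z hz h => by
      rw [hFA, Finset.mem_filter]; exact ⟨Finset.mem_univ _, hz, h⟩)
    FB (fun z h => by rw [hFB, Finset.mem_filter]; exact ⟨Finset.mem_univ _, h⟩)
    z _ _ _ _ _ _ _ _ _ _ rfl rfl rfl rfl rfl rfl rfl rfl rfl rfl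
  have one_sum : ∀ w : Fin n, ∑ z : Fin n, (if z = w then 1 else 0) = 1 := by simp
  have ind_sum : ∀ S : Finset (Fin n), ∑ z : Fin n, (if z ∈ S then 1 else 0) = S.card := by simp
  have S1 := Finset.sum_le_sum (s := Finset.univ) fun z _ => (key z).1
  have S2 := Finset.sum_le_sum (s := Finset.univ) fun z _ => (key z).2.1
  have S3 := Finset.sum_le_sum (s := Finset.univ) fun z _ => (key z).2.2.1
  have S4 := Finset.sum_le_sum (s := Finset.univ) fun z _ => (key z).2.2.2.1
  have hconst : ∀ k : ℕ, ∑ _z : Fin n, k = n * k := by simp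
  simp only [Finset.sum_add_distrib, ← Finset.mul_sum, sum_eInd, sum_eInd_on, one_sum, ind_sum,
    hconst] at S1 S2 S3 S4
  have T2 : (X.filter fun z => ({x, y₁, z} : Finset (Fin n)) ∈ H ∧
      ({x', y₁, z} : Finset (Fin n)) ∈ H).card ≤ FA.card := by
    apply Finset.card_le_card
    intro z hz
    rw [Finset.mem_filter] at hz
    exact (key z).2.2.2.2 hz.1 (eInd_of_mem hz.2.1) (eInd_of_mem hz.2.2)
  have hXY : X.card + Y.card = n := by
    rw [← Finset.card_union_of_disjoint hd, hp]; simp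
  have hsplit : degOn H x x' Finset.univ = degOn H x x' X + degOn H x x' Y := by
    unfold degOn
    rw [← hp, Finset.filter_union, Finset.card_union_of_disjoint]
    exact Finset.disjoint_filter_filter hd
  have hxY : x ∉ Y := Finset.disjoint_left.1 hd hx
  have hxY' : x' ∉ Y := Finset.disjoint_left.1 hd hx'
  have n1 : x ≠ y₁ := fun h => hxY (h ▸ hy₁)
  have n2 : x ≠ y₂ := fun h => hxY (h ▸ hy₂)
  have n3 : x' ≠ y₁ := fun h => hxY' (h ▸ hy₁)
  have n4 : x' ≠ y₂ := fun h => hxY' (h ▸ hy₂)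
  have da := hδ x x' hxx'
  have db1 := hδ x y₁ n1
  have db2 := hδ x y₂ n2
  have dc1 := hδ x' y₁ n3
  have dc2 := hδ x' y₂ n4
  have dd := hδ y₁ y₂ hy12
  have hγn : 0 ≤ γ * n := by positivity
  rify at S1 S2 S3 S4 T2 hXY hsplit cA cB
  unfold TypicalTriple
  refine ⟨by linarith, by linarith, by linarith, by linarith, by linarith, ?_, by linarith⟩
  refine le_trans T2 (by linarith)
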